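/- Let ω ≥ 1 and let p be a homogeneous polynomial of degree ω in n real variables satisfying Δ^{⌊ω/2⌋} p = 0 (the ⌊ω/2⌋-fold iterated polynomial Laplacian of p vanishes). Then there exist polynomials h_1, …, h_{⌊ω/2⌋} in n variables such that for each k, h_k is homogeneous of degree ω − 2k + 2 and Δh_k = 0, and p = Σ_{k=1}^{⌊ω/2⌋} q^{k−1} · h_k, where q = Σ_{i=1}^{n} x_i². (Consequently the restriction of p to the unit sphere S^{n−1} is a sum of at most ⌊ω/2⌋ spherical-harmonic eigenfunctions, the k-th one with eigenvalue (ω − 2k + 2)(n + ω − 2k).) -/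

import Mathlib

open MvPolynomial Finset

/-- The polynomial Laplacian `Δp = ∑ i, ∂²p/∂xᵢ²`. -/
noncomputable def polyLaplacian {n : ℕ} (p : MvPolynomial (Fin n) ℝ) :
    MvPolynomial (Fin n) ℝ :=
  ∑ i : Fin n, pderiv i (pderiv i p)

/-- The polynomial Laplacian as a linear map. -/
noncomputable def polyLaplacianLinearMap (n : ℕ) :
    MvPolynomial (Fin n) ℝ →ₗ[ℝ] MvPolynomial (Fin n) ℝ :=
  ∑ i : Fin n, (pderiv i).toLinearMap ∘ₗ (pderiv i).toLinearMap

theorem coe_polyLaplacianLinearMap (n : ℕ) :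
    ⇑(polyLaplacianLinearMap n) = polyLaplacian := by
  ext1 p
  simp [polyLaplacianLinearMap, polyLaplacian]

theorem iterate_polyLaplacian (n m : ℕ) :
    (polyLaplacian (n := n))^[m] = ⇑(polyLaplacianLinearMap n ^ m) := by
  rw [Module.End.coe_pow, coe_polyLaplacianLinearMap]

theorem MvPolynomial.IsHomogeneous.polyLaplacian {n d : ℕ} {p : MvPolynomial (Fin n) ℝ}
    (hp : p.IsHomogeneous d) : (polyLaplacian p).IsHomogeneous (d - 2) :=
  IsHomogeneous.sum _ _ _ fun _ _ => hp.pderiv.pderiv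

theorem MvPolynomial.IsHomogeneous.iterate_polyLaplacian {n d : ℕ}
    {p : MvPolynomial (Fin n) ℝ} (hp : p.IsHomogeneous d) (m : ℕ) :
    (_root_.polyLaplacian^[m] p).IsHomogeneous (d - 2 * m) := by
  induction m with
  | zero => exact hp
  | succ m ih =>
    rw [Function.iterate_succ_apply']
    exact ih.polyLaplacian

theorem isHomogeneous_sum_X_sq (n : ℕ) :
    (∑ i : Fin n, X i ^ 2 : MvPolynomial (Fin n) ℝ).IsHomogeneous 2 :=
  IsHomogeneous.sum _ _ _ fun i _ => isHomogeneous_X_pow i 2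

theorem pderiv_sum_X_sq {n : ℕ} (i : Fin n) :
    pderiv i (∑ j : Fin n, X j ^ 2 : MvPolynomial (Fin n) ℝ) = 2 * X i := by
  simp [pderiv_X, Pi.single_apply]

/-- The Laplacian of `q * f` for `f` homogeneous of degree `d`, where `q = ∑ xᵢ²`. -/
theorem polyLaplacian_sum_X_sq_mul {n d : ℕ} {f : MvPolynomial (Fin n) ℝ}
    (hf : f.IsHomogeneous d) :
    polyLaplacian ((∑ i : Fin n, X i ^ 2) * f) =
      (2 * n + 4 * d : ℝ) • f + (∑ i : Fin n, X i ^ 2) * polyLaplacian f := by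
  have key (i : Fin n) : pderiv i (pderiv i ((∑ j : Fin n, X j ^ 2) * f)) =
      2 * f + 4 * (X i * pderiv i f) + (∑ j : Fin n, X j ^ 2) * pderiv i (pderiv i f) := by
    have h2 : pderiv i (2 : MvPolynomial (Fin n) ℝ) = 0 := (pderiv i).map_natCast 2
    simp only [pderiv_mul, pderiv_sum_X_sq, map_add, pderiv_X_self, h2]
    ring
  simp only [polyLaplacian, key, sum_add_distrib, ← mul_sum, hf.sum_X_mul_pderiv]
  simp only [sum_const, card_univ, Fintype.card_fin, nsmul_eq_mul, smul_eq_C_mul, map_add,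
    map_mul, map_natCast, map_ofNat]
  ring

theorem exists_polyLaplacian_pow_succ_mul {n d : ℕ} (hn : 1 ≤ n)
    {h : MvPolynomial (Fin n) ℝ} (hd : h.IsHomogeneous d) (hh : polyLaplacian h = 0) (j : ℕ) :
    ∃ c : ℝ, 0 < c ∧ polyLaplacian ((∑ i : Fin n, X i ^ 2) ^ (j + 1) * h) =
      c • ((∑ i : Fin n, X i ^ 2) ^ j * h) := by
  have hn' : (0 : ℝ) < n := by exact_mod_cast hn
  induction j with
  | zero =>
    refine ⟨2 * n + 4 * d, by positivity, ?_⟩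
    simp [polyLaplacian_sum_X_sq_mul hd, hh]
  | succ j ih =>
    obtain ⟨c, hc, hj⟩ := ih
    refine ⟨2 * n + 4 * (2 * (j + 1) + d : ℕ) + c, by positivity, ?_⟩
    rw [pow_succ' _ (j + 1), mul_assoc,
      polyLaplacian_sum_X_sq_mul (((isHomogeneous_sum_X_sq n).pow (j + 1)).mul hd), hj,
      mul_smul_comm, ← mul_assoc, ← pow_succ', ← add_smul]

theorem exists_iterate_polyLaplacian_pow_mul {n d : ℕ} (hn : 1 ≤ n)
    {h : MvPolynomial (Fin n) ℝ} (hd : h.IsHomogeneous d) (hh : polyLaplacian h = 0) (m : ℕ) :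
    ∃ c : ℝ, 0 < c ∧ polyLaplacian^[m] ((∑ i : Fin n, X i ^ 2) ^ m * h) = c • h := by
  induction m with
  | zero => exact ⟨1, one_pos, by simp⟩
  | succ m ih =>
    obtain ⟨c, hc, hm⟩ := ih
    obtain ⟨c', hc', hm'⟩ := exists_polyLaplacian_pow_succ_mul hn hd hh m
    refine ⟨c' * c, mul_pos hc' hc, ?_⟩
    rw [Function.iterate_succ_apply, hm', iterate_polyLaplacian, map_smul,
      ← iterate_polyLaplacian, hm, smul_smul]

/-- Almansi decomposition of a homogeneous polyharmonic polynomial. -/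
theorem exists_harmonic_decomposition {n d m : ℕ} (hn : 1 ≤ n) (hm : 2 * m ≤ d + 1)
    {p : MvPolynomial (Fin n) ℝ} (hp : p.IsHomogeneous d) (hΔ : polyLaplacian^[m] p = 0) :
    ∃ h : ℕ → MvPolynomial (Fin n) ℝ,
      (∀ k < m, (h k).IsHomogeneous (d - 2 * k) ∧ polyLaplacian (h k) = 0) ∧
      p = ∑ k ∈ range m, (∑ i : Fin n, X i ^ 2) ^ k * h k := by
  induction m generalizing p with
  | zero => exact ⟨0, by simp, by simpa using hΔ⟩
  | succ m ih =>
    set r := polyLaplacian^[m] p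
    have hrd : r.IsHomogeneous (d - 2 * m) := hp.iterate_polyLaplacian m
    have hrh : polyLaplacian r = 0 := by rwa [Function.iterate_succ_apply'] at hΔ
    obtain ⟨c, hc, hcr⟩ := exists_iterate_polyLaplacian_pow_mul hn hrd hrh m
    have hgd : (c⁻¹ • r).IsHomogeneous (d - 2 * m) := by
      rw [smul_eq_C_mul]
      exact hrd.C_mul _
    have hgh : polyLaplacian (c⁻¹ • r) = 0 := by
      rw [← coe_polyLaplacianLinearMap, map_smul, coe_polyLaplacianLinearMap, hrh, smul_zero]
    have hqd : ((∑ i : Fin n, X i ^ 2) ^ m * (c⁻¹ • r)).IsHomogeneous d := by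
      have := ((isHomogeneous_sum_X_sq n).pow m).mul hgd
      rwa [Nat.add_sub_cancel' (by lia)] at this
    obtain ⟨h, hh, hsum⟩ := ih (by lia) (hp.sub hqd) (by
      rw [iterate_polyLaplacian, map_sub, mul_smul_comm, map_smul, ← iterate_polyLaplacian,
        hcr, inv_smul_smul₀ hc.ne', sub_self])
    refine ⟨Function.update h m (c⁻¹ • r), fun k hk => ?_, ?_⟩
    · rcases Nat.lt_succ_iff_lt_or_eq.mp hk with hk | rfl
      · simpa [hk.ne] using hh k hk
      · simpa using ⟨hgd, hgh⟩
    · rw [sum_range_succ, Function.update_self, ← sub_eq_iff_eq_add, hsum]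
      refine sum_congr rfl fun k hk => ?_
      rw [Function.update_of_ne (mem_range.mp hk).ne]

/-- If `p` is homogeneous of degree `ω ≥ 1` and `Δ^⌊ω/2⌋ p = 0`, then
`p = ∑_{k=1}^{⌊ω/2⌋} q^{k-1} · h_k` where each `h_k` is harmonic and homogeneous of
degree `ω - 2k + 2`, with `q = ∑ xᵢ²`. -/
theorem decomposition_of_polyharmonic (n ω : ℕ) (hn : 1 ≤ n) (hω : 1 ≤ ω)
    (p : MvPolynomial (Fin n) ℝ) (hp : p.IsHomogeneous ω)
    (hΔ : polyLaplacian^[ω / 2] p = 0) :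
    ∃ h : ℕ → MvPolynomial (Fin n) ℝ,
      (∀ k, 1 ≤ k → k ≤ ω / 2 → (h k).IsHomogeneous (ω - 2 * k + 2)) ∧
      (∀ k, 1 ≤ k → k ≤ ω / 2 → polyLaplacian (h k) = 0) ∧
      p = ∑ k ∈ Finset.Icc 1 (ω / 2), (∑ i : Fin n, X i ^ 2) ^ (k - 1) * h k := by
  obtain ⟨h, hh, hsum⟩ := exists_harmonic_decomposition hn (by lia) hp hΔ
  refine ⟨fun k => h (k - 1), fun k hk hkω => ?_, fun k hk hkω => (hh (k - 1) (by lia)).2, ?_⟩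
  · rw [show ω - 2 * k + 2 = ω - 2 * (k - 1) by lia]
    exact (hh (k - 1) (by lia)).1
  · rw [hsum, range_eq_Ico, sum_Ico_eq_sum_range, ← Ico_add_one_right_eq_Icc,
      sum_Ico_eq_sum_range]
    simp
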